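/- arXiv:2412.05470 — 2 statements merged into one kernel-verified Lean document; each statement's English description precedes it below -/
import Mathlib

section
/- Let p be a prime with p > 3 and let s > 0 be real. Let μ be the Haar measure on ℚ_p² normalized so that μ(ℤ_p²) = 1. Then ∫_{ℤ_p²} |y³ − x³ y|_p^s dμ(x,y) = p^{3s} (p−1) ( p^{7s+5} − p^{7s+4} + p^{6s+4} − p^{6s+3} + p^{4s+3} − p^{3s+2} + p^{2s+2} − p^{2s+1} + p^{s+1} − 1 ) / [ (p^{9s+5} − 1)(p^{s+1} − 1) ]. -/
open MeasureTheory

/-- The ball of radius `p⁻ⁿ` about `0` in `ℚ_[p]`, that is, `pⁿ ℤ_[p]`. -/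
def padicBall (p : ℕ) [Fact p.Prime] (n : ℕ) : Set ℚ_[p] :=
  Metric.closedBall 0 ((p : ℝ)⁻¹ ^ n)

section PadicBall

variable {p : ℕ} [Fact p.Prime]

theorem inv_prime_pos : 0 < (p : ℝ)⁻¹ :=
  inv_pos.2 (mod_cast (Fact.out : p.Prime).pos)

theorem inv_prime_lt_one : (p : ℝ)⁻¹ < 1 :=
  inv_lt_one_of_one_lt₀ (mod_cast (Fact.out : p.Prime).one_lt)

theorem mem_padicBall {n : ℕ} {x : ℚ_[p]} : x ∈ padicBall p n ↔ ‖x‖ ≤ (p : ℝ)⁻¹ ^ n := by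
  simp [padicBall]

theorem isCompact_padicBall (n : ℕ) : IsCompact (padicBall p n) :=
  isCompact_closedBall _ _

theorem padicBall_succ_subset (n : ℕ) : padicBall p (n + 1) ⊆ padicBall p n :=
  Metric.closedBall_subset_closedBall
    (pow_le_pow_of_le_one inv_prime_pos.le inv_prime_lt_one.le n.le_succ)

theorem mem_padicBall_diff {n : ℕ} {x : ℚ_[p]} :
    x ∈ padicBall p n \ padicBall p (n + 1) ↔ ‖x‖ = (p : ℝ)⁻¹ ^ n := by
  have hp : 1 < (p : ℝ) := mod_cast (Fact.out : p.Prime).one_lt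
  rw [Set.mem_sdiff, mem_padicBall, mem_padicBall]
  constructor
  · rintro ⟨h1, h2⟩
    have h := Padic.norm_le_pow_iff_norm_lt_pow_add_one x (-(n + 1 : ℕ) : ℤ)
    rw [zpow_neg, zpow_natCast, ← inv_pow] at h
    rw [h, Nat.cast_succ, neg_add, neg_add_cancel_right, zpow_neg, zpow_natCast, ← inv_pow] at h2
    exact le_antisymm h1 (not_lt.1 h2)
  · intro h
    rw [h]
    exact ⟨le_rfl, not_le.2 (pow_lt_pow_right_of_lt_one₀ inv_prime_pos inv_prime_lt_one
      n.lt_succ_self)⟩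

theorem norm_prime_pow (n : ℕ) : ‖(p : ℚ_[p]) ^ n‖ = (p : ℝ)⁻¹ ^ n := by
  rw [norm_pow, Padic.norm_p]

theorem preimage_mul_padicBall {c : ℚ_[p]} {k : ℕ} (hc : ‖c‖ = (p : ℝ)⁻¹ ^ k) (n : ℕ) :
    (c * ·) ⁻¹' padicBall p (k + n) = padicBall p n := by
  ext x
  simp only [Set.mem_preimage, mem_padicBall, norm_mul, hc, pow_add]
  exact mul_le_mul_iff_right₀ (pow_pos inv_prime_pos k)

theorem padicBall_zero_eq_iUnion :
    padicBall p 0 = ⋃ i : Fin p, (fun x ↦ -(i : ℚ_[p]) + x) ⁻¹' padicBall p 1 := by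
  ext x
  simp only [Set.mem_iUnion, Set.mem_preimage, mem_padicBall, pow_zero, pow_one]
  have hlt (y : ℚ_[p]) : ‖y‖ ≤ (p : ℝ)⁻¹ ↔ ‖y‖ < 1 := by
    have h := Padic.norm_le_pow_iff_norm_lt_pow_add_one y (-1)
    rwa [zpow_neg_one, neg_add_cancel, zpow_zero] at h
  constructor
  · intro hx
    obtain ⟨y, rfl⟩ : ∃ y : ℤ_[p], (y : ℚ_[p]) = x := ⟨⟨x, hx⟩, rfl⟩
    obtain ⟨n, hn, h⟩ := PadicInt.exists_mem_range y
    refine ⟨⟨n, hn⟩, (hlt _).2 ?_⟩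
    rw [PadicInt.maximalIdeal_eq_span_p, Ideal.mem_span_singleton,
      ← PadicInt.norm_lt_one_iff_dvd] at h
    rw [neg_add_eq_sub]
    rwa [PadicInt.norm_def, PadicInt.coe_sub, PadicInt.coe_natCast] at h
  · rintro ⟨i, hi⟩
    have h2 : ‖((i : ℕ) : ℚ_[p])‖ ≤ 1 := by exact mod_cast Padic.norm_int_le_one (p := p) (i : ℕ)
    calc ‖x‖ = ‖(i : ℚ_[p]) + (-(i : ℚ_[p]) + x)‖ := by rw [add_neg_cancel_left]
      _ ≤ max ‖((i : ℕ) : ℚ_[p])‖ ‖-(i : ℚ_[p]) + x‖ := Padic.nonarchimedean _ _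
      _ ≤ 1 := max_le h2 ((hlt _).1 hi).le

theorem pairwise_disjoint_cosets :
    Pairwise (Function.onFun Disjoint
      fun i : Fin p ↦ (fun x ↦ -(i : ℚ_[p]) + x) ⁻¹' padicBall p 1) := by
  intro i j hij
  rw [Function.onFun, Set.disjoint_left]
  intro x hi hj
  simp only [Set.mem_preimage, mem_padicBall, pow_one] at hi hj
  have h : ‖(((i : ℤ) - (j : ℤ) : ℤ) : ℚ_[p])‖ < 1 := by
    have e : (((i : ℤ) - (j : ℤ) : ℤ) : ℚ_[p])
        = (-((j : ℕ) : ℚ_[p]) + x) - (-((i : ℕ) : ℚ_[p]) + x) := by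
      push_cast; ring
    rw [e, sub_eq_add_neg]
    exact ((Padic.nonarchimedean _ _).trans
      (max_le hj ((norm_neg _).trans_le hi))).trans_lt inv_prime_lt_one
  rw [Padic.norm_intCast_lt_one_iff] at h
  have := Int.eq_zero_of_abs_lt_dvd h (by rw [abs_lt]; omega)
  exact hij (Fin.ext (by omega))

theorem continuous_norm_rpow {s : ℝ} (hs : 0 < s) : Continuous fun y : ℚ_[p] ↦ ‖y‖ ^ s :=
  continuous_norm.rpow_const fun _ ↦ Or.inr hs.le

theorem norm_sub_eq_one_of_lt {x y : ℚ_[p]} (hx : ‖x‖ = 1) (hy : ‖y‖ < 1) : ‖x - y‖ = 1 := by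
  rw [sub_eq_add_neg, Padic.add_eq_max_of_ne (by rw [norm_neg, hx]; exact hy.ne'), norm_neg, hx,
    max_eq_left hy.le]

theorem norm_lt_one_of_mem_padicBall_succ {n : ℕ} {x : ℚ_[p]} (hx : x ∈ padicBall p (n + 1)) :
    ‖x‖ < 1 :=
  (mem_padicBall.1 hx).trans_lt (pow_lt_one₀ inv_prime_pos.le inv_prime_lt_one n.succ_ne_zero)

theorem norm_cube_sub_cube_mul_of_lt {x y : ℚ_[p]} (h : ‖x‖ ^ 3 < ‖y‖ ^ 2) :
    ‖y ^ 3 - x ^ 3 * y‖ = ‖y‖ ^ 3 := by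
  have hy : 0 < ‖y‖ := by
    by_contra! h0
    rw [le_antisymm h0 (norm_nonneg y)] at h
    exact absurd h (not_lt.2 (by rw [zero_pow two_ne_zero]; positivity))
  have hlt : ‖-(x ^ 3 * y)‖ < ‖y ^ 3‖ := by
    rw [norm_neg, norm_mul, norm_pow, norm_pow, pow_succ ‖y‖ 2]
    exact mul_lt_mul_of_pos_right h hy
  rw [sub_eq_add_neg, Padic.add_eq_max_of_ne hlt.ne', max_eq_left hlt.le, norm_pow]

theorem norm_cube_sub_cube_mul_of_gt {x y : ℚ_[p]} (h : ‖y‖ ^ 2 < ‖x‖ ^ 3) :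
    ‖y ^ 3 - x ^ 3 * y‖ = ‖x‖ ^ 3 * ‖y‖ := by
  rcases eq_or_ne y 0 with rfl | hy
  · simp
  have hlt : ‖y ^ 3‖ < ‖-(x ^ 3 * y)‖ := by
    rw [norm_neg, norm_mul, norm_pow, norm_pow, pow_succ ‖y‖ 2]
    exact mul_lt_mul_of_pos_right h (norm_pos_iff.2 hy)
  rw [sub_eq_add_neg, Padic.add_eq_max_of_ne hlt.ne, max_eq_right hlt.le, norm_neg, norm_mul,
    norm_pow]

theorem continuous_norm_cube_sub_cube_mul_rpow {s : ℝ} (hs : 0 < s) :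
    Continuous fun z : ℚ_[p] × ℚ_[p] ↦ ‖z.2 ^ 3 - z.1 ^ 3 * z.2‖ ^ s :=
  (continuous_norm_rpow hs).comp (by fun_prop)

variable [MeasurableSpace ℚ_[p]] [BorelSpace ℚ_[p]]

theorem measurableSet_padicBall (n : ℕ) : MeasurableSet (padicBall p n) :=
  measurableSet_closedBall

variable (m : Measure ℚ_[p]) [m.IsAddHaarMeasure]

theorem measureReal_padicBall_one (hm : m (padicBall p 0) = 1) :
    m.real (padicBall p 1) = (p : ℝ)⁻¹ := by
  have h : m (padicBall p 0) = p * m (padicBall p 1) := by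
    rw [padicBall_zero_eq_iUnion, measure_iUnion pairwise_disjoint_cosets
      fun i ↦ (measurable_const_add _) (measurableSet_padicBall 1)]
    simp [measure_preimage_add]
  rw [hm] at h
  have hp : (p : ℝ) ≠ 0 := mod_cast (Fact.out : p.Prime).ne_zero
  have := congrArg ENNReal.toReal h
  rw [ENNReal.toReal_one, ENNReal.toReal_mul, ENNReal.toReal_natCast] at this
  rw [measureReal_def, eq_inv_of_mul_eq_one_right this.symm]

theorem exists_map_mul_left_eq_smul {c : ℚ_[p]} (hc : c ≠ 0) :
    ∃ a : NNReal, m.map (c * ·) = a • m := by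
  have : (m.map (c * ·)).IsAddHaarMeasure :=
    (DistribMulAction.toAddEquiv₀ ℚ_[p] c hc).isAddHaarMeasure_map m
      (continuous_const_mul c) (continuous_const_mul c⁻¹)
  exact ⟨_, Measure.isAddLeftInvariant_eq_smul _ _⟩

theorem exists_measureReal_padicBall_add {c : ℚ_[p]} {k : ℕ} (hc : ‖c‖ = (p : ℝ)⁻¹ ^ k) :
    ∃ a : NNReal, m.map (c * ·) = a • m ∧
      ∀ n, m.real (padicBall p n) = a * m.real (padicBall p (k + n)) := by
  have hc0 : c ≠ 0 := norm_pos_iff.1 (hc ▸ pow_pos inv_prime_pos k)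
  obtain ⟨a, ha⟩ := exists_map_mul_left_eq_smul m hc0
  refine ⟨a, ha, fun n ↦ ?_⟩
  rw [← preimage_mul_padicBall hc n, ← map_measureReal_apply (measurable_const_mul c)
    (measurableSet_padicBall _), ha]
  simp

theorem measureReal_padicBall (hm : m (padicBall p 0) = 1) (n : ℕ) :
    m.real (padicBall p n) = (p : ℝ)⁻¹ ^ n := by
  induction n with
  | zero => simp [measureReal_def, hm]
  | succ n ih =>
    obtain ⟨a, -, ha⟩ := exists_measureReal_padicBall_add m (norm_prime_pow (p := p) n)
    have h0 := ha 0
    have h1 := ha 1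
    rw [measureReal_padicBall_one m hm] at h1
    rw [add_zero, ih, measureReal_def, hm, ENNReal.toReal_one] at h0
    calc m.real (padicBall p (n + 1))
        = (p : ℝ)⁻¹ ^ n * (a * m.real (padicBall p (n + 1))) := by
          linear_combination m.real (padicBall p (n + 1)) * h0
      _ = (p : ℝ)⁻¹ ^ (n + 1) := by rw [← h1, pow_succ]

/-- Multiplication by an element of absolute value `p⁻ᵏ` scales Haar measure by `p⁻ᵏ`. -/
theorem setIntegral_padicBall_add (hm : m (padicBall p 0) = 1) {c : ℚ_[p]} {k : ℕ}
    (hc : ‖c‖ = (p : ℝ)⁻¹ ^ k) (n : ℕ) (g : ℚ_[p] → ℝ) :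
    ∫ x in padicBall p (k + n), g x ∂m
      = (p : ℝ)⁻¹ ^ k * ∫ x in padicBall p n, g (c * x) ∂m := by
  have hc0 : c ≠ 0 := norm_pos_iff.1 (hc ▸ pow_pos inv_prime_pos k)
  obtain ⟨a, ha, hb⟩ := exists_measureReal_padicBall_add m hc
  have h0 := hb 0
  rw [measureReal_padicBall m hm, measureReal_padicBall m hm, pow_zero, add_zero] at h0
  have h := (MeasurableEquiv.mulLeft₀ c hc0).measurableEmbedding.setIntegral_map (μ := m) g
    (padicBall p (k + n))
  simp only [MeasurableEquiv.coe_mulLeft₀, preimage_mul_padicBall hc, ha,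
    Measure.restrict_smul] at h
  rw [← h, integral_smul_nnreal_measure, NNReal.smul_def, smul_eq_mul]
  linear_combination (∫ x in padicBall p (k + n), g x ∂m) * h0

theorem measureReal_padicBall_diff (hm : m (padicBall p 0) = 1) (n : ℕ) :
    m.real (padicBall p n \ padicBall p (n + 1)) = (p : ℝ)⁻¹ ^ n * (1 - (p : ℝ)⁻¹) := by
  rw [measureReal_sdiff (padicBall_succ_subset n) (measurableSet_padicBall _)
    (isCompact_padicBall _).measure_ne_top, measureReal_padicBall m hm, measureReal_padicBall m hm]
  ring

variable (s : ℝ)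

/-- The local zeta function of a single variable, `∫_{ℤ_p} |y|^s dy`. -/
noncomputable def normPowIntegral : ℝ := ∫ y in padicBall p 0, ‖y‖ ^ s ∂m

variable {s}

theorem setIntegral_norm_rpow_padicBall (hm : m (padicBall p 0) = 1) (n : ℕ) :
    ∫ y in padicBall p n, ‖y‖ ^ s ∂m
      = (p : ℝ)⁻¹ ^ n * ((p : ℝ)⁻¹ ^ s) ^ n * normPowIntegral m s := by
  have h := setIntegral_padicBall_add m hm (norm_prime_pow (p := p) n) 0 (fun y ↦ ‖y‖ ^ s)
  rw [add_zero] at h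
  rw [h, mul_assoc, normPowIntegral, ← integral_const_mul (((p : ℝ)⁻¹ ^ s) ^ n)]
  congr! 3 with y
  rw [norm_mul, norm_prime_pow, Real.mul_rpow (by positivity) (norm_nonneg _),
    Real.rpow_pow_comm inv_prime_pos.le]

theorem setIntegral_norm_rpow_padicBall_diff (hm : m (padicBall p 0) = 1) (n : ℕ) (s : ℝ) :
    ∫ y in padicBall p n \ padicBall p (n + 1), ‖y‖ ^ s ∂m
      = (p : ℝ)⁻¹ ^ n * (1 - (p : ℝ)⁻¹) * ((p : ℝ)⁻¹ ^ s) ^ n := by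
  rw [setIntegral_congr_fun (g := fun _ ↦ ((p : ℝ)⁻¹ ^ s) ^ n)
    ((measurableSet_padicBall n).diff (measurableSet_padicBall _))]
  · rw [setIntegral_const, measureReal_padicBall_diff m hm, smul_eq_mul]
  · intro y hy
    simp only
    rw [mem_padicBall_diff.1 hy, Real.rpow_pow_comm inv_prime_pos.le]

theorem normPowIntegral_eq (hm : m (padicBall p 0) = 1) (hs : 0 < s) :
    normPowIntegral m s
      = 1 - (p : ℝ)⁻¹ + (p : ℝ)⁻¹ * (p : ℝ)⁻¹ ^ s * normPowIntegral m s := by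
  have h := setIntegral_sdiff (μ := m) (f := fun y ↦ ‖y‖ ^ s) (measurableSet_padicBall (p := p) 1)
    ((continuous_norm_rpow hs).continuousOn.integrableOn_compact (isCompact_padicBall 0))
    (padicBall_succ_subset 0)
  rw [setIntegral_norm_rpow_padicBall m hm 1,
    setIntegral_norm_rpow_padicBall_diff m hm 0, ← normPowIntegral] at h
  linear_combination -h

/-- `∫_{ℤ_p} |a - x|^s dx` does not depend on `a ∈ ℤ_p`. -/
theorem setIntegral_norm_sub_rpow {a : ℚ_[p]} (ha : a ∈ padicBall p 0) :
    ∫ x in padicBall p 0, ‖a - x‖ ^ s ∂m = normPowIntegral m s := by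
  have h := (Measure.measurePreserving_sub_left m a).setIntegral_preimage_emb
    (MeasurableEquiv.subLeft a).measurableEmbedding (fun y ↦ ‖y‖ ^ s) (padicBall p 0)
  rw [normPowIntegral, ← h]
  congr 2
  ext x
  rw [Set.mem_preimage]
  rw [mem_padicBall, pow_zero] at *
  constructor <;> intro hx
  · rw [mem_padicBall, pow_zero, sub_eq_add_neg]
    exact (Padic.nonarchimedean _ _).trans (max_le ha (by rwa [norm_neg]))
  · rw [mem_padicBall, pow_zero] at hx
    rw [← sub_sub_cancel a x, sub_eq_add_neg]
    exact (Padic.nonarchimedean _ _).trans (max_le ha (by rwa [norm_neg]))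

theorem setIntegral_norm_sub_rpow_units_of_norm_lt (hm : m (padicBall p 0) = 1) {a : ℚ_[p]}
    (ha : ‖a‖ < 1) :
    ∫ x in padicBall p 0 \ padicBall p 1, ‖a - x‖ ^ s ∂m = 1 - (p : ℝ)⁻¹ := by
  rw [setIntegral_congr_fun (g := fun _ ↦ (1 : ℝ))
    ((measurableSet_padicBall 0).diff (measurableSet_padicBall _))]
  · simp [measureReal_padicBall_diff m hm 0]
  · intro x hx
    simp only
    rw [norm_sub_rev, norm_sub_eq_one_of_lt ((mem_padicBall_diff (n := 0)).1 hx) ha,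
      Real.one_rpow]

theorem setIntegral_norm_sub_rpow_units_of_norm_eq (hm : m (padicBall p 0) = 1) (hs : 0 < s)
    {a : ℚ_[p]} (ha : ‖a‖ = 1) :
    ∫ x in padicBall p 0 \ padicBall p 1, ‖a - x‖ ^ s ∂m
      = normPowIntegral m s - (p : ℝ)⁻¹ := by
  rw [setIntegral_sdiff (measurableSet_padicBall 1) _ (padicBall_succ_subset 0),
    setIntegral_norm_sub_rpow m (mem_padicBall.2 (by simp [ha])),
    setIntegral_congr_fun (g := fun _ ↦ (1 : ℝ)) (measurableSet_padicBall 1)]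
  · simp [measureReal_padicBall m hm]
  · intro x hx
    simp only
    rw [norm_sub_eq_one_of_lt ha (norm_lt_one_of_mem_padicBall_succ hx), Real.one_rpow]
  · exact ((continuous_norm_rpow hs).comp
      (continuous_const.sub continuous_id)).continuousOn.integrableOn_compact (isCompact_padicBall 0)

theorem setIntegral_padicBall_prod_eq_add {F : ℚ_[p] × ℚ_[p] → ℝ} (hF : Continuous F) (k n : ℕ) :
    ∫ z in padicBall p k ×ˢ padicBall p n, F z ∂m.prod m
      = ∫ z in (padicBall p k \ padicBall p (k + 1)) ×ˢ padicBall p n, F z ∂m.prod m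
        + ∫ z in padicBall p (k + 1) ×ˢ padicBall p n, F z ∂m.prod m := by
  have hint := hF.continuousOn.integrableOn_compact (μ := m.prod m)
    ((isCompact_padicBall k).prod (isCompact_padicBall n))
  rw [← setIntegral_union (Set.Disjoint.set_prod_left Set.disjoint_sdiff_left _ _)
    ((measurableSet_padicBall _).prod (measurableSet_padicBall _))
    (hint.mono_set (Set.prod_mono Set.sdiff_subset subset_rfl))
    (hint.mono_set (Set.prod_mono (padicBall_succ_subset k) subset_rfl)), ← Set.union_prod,
    Set.sdiff_union_of_subset (padicBall_succ_subset k)]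

theorem setIntegral_prod_padicBall_eq_add {F : ℚ_[p] × ℚ_[p] → ℝ} (hF : Continuous F)
    {T : Set ℚ_[p]} (hTm : MeasurableSet T) (hT : T ⊆ padicBall p 0) (n : ℕ) :
    ∫ z in T ×ˢ padicBall p n, F z ∂m.prod m
      = ∫ z in T ×ˢ (padicBall p n \ padicBall p (n + 1)), F z ∂m.prod m
        + ∫ z in T ×ˢ padicBall p (n + 1), F z ∂m.prod m := by
  have hint := hF.continuousOn.integrableOn_compact (μ := m.prod m)
    ((isCompact_padicBall 0).prod (isCompact_padicBall n))
  rw [← setIntegral_union (Set.Disjoint.set_prod_right Set.disjoint_sdiff_left _ _)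
    (hTm.prod (measurableSet_padicBall _))
    (hint.mono_set (Set.prod_mono hT Set.sdiff_subset))
    (hint.mono_set (Set.prod_mono hT (padicBall_succ_subset n))), ← Set.prod_union,
    Set.sdiff_union_of_subset (padicBall_succ_subset n)]

theorem setIntegral_units_prod (hm : m (padicBall p 0) = 1) (hs : 0 < s) :
    ∫ z in (padicBall p 0 \ padicBall p 1) ×ˢ padicBall p 0,
        ‖z.2 ^ 3 - z.1 ^ 3 * z.2‖ ^ s ∂m.prod m
      = (1 - (p : ℝ)⁻¹) * (normPowIntegral m s - (p : ℝ)⁻¹)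
        + (p : ℝ)⁻¹ * (p : ℝ)⁻¹ ^ s * normPowIntegral m s * (1 - (p : ℝ)⁻¹) := by
  have hU : MeasurableSet (padicBall p 0 \ padicBall p 1) :=
    (measurableSet_padicBall 0).diff (measurableSet_padicBall 1)
  have hsub : (padicBall p 0 \ padicBall p 1) ×ˢ padicBall p 0 ⊆ padicBall p 0 ×ˢ padicBall p 0 :=
    Set.prod_mono Set.sdiff_subset subset_rfl
  have hcpt := (isCompact_padicBall (p := p) 0).prod (isCompact_padicBall (p := p) 0)
  rw [setIntegral_prod _ (((continuous_norm_cube_sub_cube_mul_rpow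
    hs).continuousOn.integrableOn_compact hcpt).mono_set hsub)]
  have hsubst : ∀ x ∈ padicBall p 0 \ padicBall p 1,
      ∫ y in padicBall p 0, ‖y ^ 3 - x ^ 3 * y‖ ^ s ∂m
        = ∫ u in padicBall p 0, ‖u‖ ^ s * ‖u ^ 2 - x‖ ^ s ∂m := by
    intro x hx
    have hx1 := (mem_padicBall_diff (n := 0)).1 hx
    rw [setIntegral_padicBall_add m hm hx1 0 fun y ↦ ‖y ^ 3 - x ^ 3 * y‖ ^ s, pow_zero, one_mul]
    refine integral_congr_ae (.of_forall fun u ↦ ?_)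
    simp only
    rw [← Real.mul_rpow (norm_nonneg _) (norm_nonneg _), ← norm_mul,
      show (x * u) ^ 3 - x ^ 3 * (x * u) = x ^ 3 * (u * (u ^ 2 - x)) by ring, norm_mul, norm_pow,
      hx1, pow_zero, one_pow, one_mul]
  rw [setIntegral_congr_fun hU hsubst, integral_integral_swap]
  swap
  · rw [Measure.prod_restrict]
    refine IntegrableOn.mono_set (ContinuousOn.integrableOn_compact hcpt
      (Continuous.continuousOn ?_)) hsub
    exact ((continuous_norm_rpow hs).comp continuous_snd).mul
      ((continuous_norm_rpow hs).comp (by fun_prop))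
  simp_rw [integral_const_mul]
  have h0 : Set.EqOn (fun u : ℚ_[p] ↦ ‖u‖ ^ s * (normPowIntegral m s - (p : ℝ)⁻¹))
      (fun u ↦ ‖u‖ ^ s * ∫ x in padicBall p 0 \ padicBall p 1, ‖u ^ 2 - x‖ ^ s ∂m)
      (padicBall p 0 \ padicBall p 1) := by
    intro u hu
    simp only
    rw [setIntegral_norm_sub_rpow_units_of_norm_eq m hm hs]
    rw [norm_pow, (mem_padicBall_diff (n := 0)).1 hu, pow_zero, one_pow]
  have h1 : Set.EqOn (fun u : ℚ_[p] ↦ ‖u‖ ^ s * (1 - (p : ℝ)⁻¹))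
      (fun u ↦ ‖u‖ ^ s * ∫ x in padicBall p 0 \ padicBall p 1, ‖u ^ 2 - x‖ ^ s ∂m)
      (padicBall p 1) := by
    intro u hu
    simp only
    rw [setIntegral_norm_sub_rpow_units_of_norm_lt m hm]
    rw [norm_pow]
    exact pow_lt_one₀ (norm_nonneg _) (norm_lt_one_of_mem_padicBall_succ hu) two_ne_zero
  have hint (a : ℝ) : IntegrableOn (fun u : ℚ_[p] ↦ ‖u‖ ^ s * a) (padicBall p 0) m :=
    ((continuous_norm_rpow hs).mul_const a).continuousOn.integrableOn_compact
      (isCompact_padicBall 0)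
  have hunion := setIntegral_union Set.disjoint_sdiff_left (measurableSet_padicBall 1)
    (((hint _).mono_set Set.sdiff_subset).congr_fun h0 hU)
    (((hint _).mono_set (padicBall_succ_subset 0)).congr_fun h1 (measurableSet_padicBall 1))
  rw [Set.sdiff_union_of_subset (padicBall_succ_subset 0)] at hunion
  rw [hunion, ← setIntegral_congr_fun hU h0, ← setIntegral_congr_fun (measurableSet_padicBall 1) h1,
    integral_mul_const, integral_mul_const, setIntegral_norm_rpow_padicBall m hm 1,
    setIntegral_norm_rpow_padicBall_diff m hm 0]
  ring

theorem setIntegral_prod_sphere (hm : m (padicBall p 0) = 1) {T : Set ℚ_[p]} {j : ℕ}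
    (hT : MeasurableSet T) (hTj : ∀ x ∈ T, ‖x‖ ^ 3 < ((p : ℝ)⁻¹ ^ j) ^ 2) (s : ℝ) :
    ∫ z in T ×ˢ (padicBall p j \ padicBall p (j + 1)), ‖z.2 ^ 3 - z.1 ^ 3 * z.2‖ ^ s ∂m.prod m
      = m.real T * ((p : ℝ)⁻¹ ^ j * (1 - (p : ℝ)⁻¹)) * ((p : ℝ)⁻¹ ^ s) ^ (3 * j) := by
  rw [setIntegral_congr_fun (g := fun _ ↦ ((p : ℝ)⁻¹ ^ s) ^ (3 * j))
    (hT.prod ((measurableSet_padicBall j).diff (measurableSet_padicBall _)))]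
  · rw [setIntegral_const, measureReal_prod_prod, measureReal_padicBall_diff m hm, smul_eq_mul]
  · rintro ⟨x, y⟩ ⟨hx, hy⟩
    have hy1 : ‖y‖ = (p : ℝ)⁻¹ ^ j := mem_padicBall_diff.1 hy
    simp only
    rw [norm_cube_sub_cube_mul_of_lt (by rw [hy1]; exact hTj x hx), hy1, ← pow_mul, mul_comm j,
      Real.rpow_pow_comm inv_prime_pos.le]

theorem setIntegral_sphere_prod_padicBall_two (hm : m (padicBall p 0) = 1) (s : ℝ) :
    ∫ z in (padicBall p 1 \ padicBall p 2) ×ˢ padicBall p 2,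
        ‖z.2 ^ 3 - z.1 ^ 3 * z.2‖ ^ s ∂m.prod m
      = (p : ℝ)⁻¹ ^ 3 * (1 - (p : ℝ)⁻¹) * ((p : ℝ)⁻¹ ^ s) ^ 5 * normPowIntegral m s := by
  rw [setIntegral_congr_fun (g := fun z ↦ ((p : ℝ)⁻¹ ^ s) ^ 3 * ‖z.2‖ ^ s)
    (((measurableSet_padicBall 1).diff (measurableSet_padicBall 2)).prod
      (measurableSet_padicBall 2)),
    setIntegral_prod_mul (fun _ ↦ ((p : ℝ)⁻¹ ^ s) ^ 3) (fun y : ℚ_[p] ↦ ‖y‖ ^ s)]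
  · rw [setIntegral_const, measureReal_padicBall_diff m hm 1, smul_eq_mul,
      setIntegral_norm_rpow_padicBall m hm]
    ring
  · rintro ⟨x, y⟩ ⟨hx, hy⟩
    have hx1 : ‖x‖ = (p : ℝ)⁻¹ := by simpa using (mem_padicBall_diff (n := 1)).1 hx
    have hlt : ‖y‖ ^ 2 < ‖x‖ ^ 3 := by
      rw [hx1]
      calc ‖y‖ ^ 2 ≤ ((p : ℝ)⁻¹ ^ 2) ^ 2 :=
            pow_le_pow_left₀ (norm_nonneg _) (mem_padicBall.1 hy) 2
        _ = (p : ℝ)⁻¹ ^ 4 := by ring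
        _ < (p : ℝ)⁻¹ ^ 3 :=
            pow_lt_pow_right_of_lt_one₀ inv_prime_pos inv_prime_lt_one (by norm_num)
    simp only
    rw [norm_cube_sub_cube_mul_of_gt hlt, Real.mul_rpow (by positivity) (norm_nonneg _), hx1,
      Real.rpow_pow_comm inv_prime_pos.le]

theorem setIntegral_padicBall_two_prod_three (hm : m (padicBall p 0) = 1) (hs : 0 < s) :
    ∫ z in padicBall p 2 ×ˢ padicBall p 3, ‖z.2 ^ 3 - z.1 ^ 3 * z.2‖ ^ s ∂m.prod m
      = (p : ℝ)⁻¹ ^ 5 * ((p : ℝ)⁻¹ ^ s) ^ 9 *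
        ∫ z in padicBall p 0 ×ˢ padicBall p 0, ‖z.2 ^ 3 - z.1 ^ 3 * z.2‖ ^ s ∂m.prod m := by
  have hint (k n : ℕ) := (continuous_norm_cube_sub_cube_mul_rpow (p := p)
    hs).continuousOn.integrableOn_compact (μ := m.prod m)
    ((isCompact_padicBall k).prod (isCompact_padicBall n))
  rw [setIntegral_prod _ (hint 2 3), setIntegral_prod _ (hint 0 0),
    setIntegral_padicBall_add m hm (norm_prime_pow 2) 0]
  simp_rw [setIntegral_padicBall_add m hm (norm_prime_pow 3) 0]
  rw [integral_const_mul, ← mul_assoc, ← pow_add, mul_assoc,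
    ← integral_const_mul (((p : ℝ)⁻¹ ^ s) ^ 9)]
  congr! 3 with x
  rw [← integral_const_mul]
  refine integral_congr_ae (.of_forall fun y ↦ ?_)
  simp only
  rw [Real.rpow_pow_comm inv_prime_pos.le, ← Real.mul_rpow (by positivity) (norm_nonneg _),
    ← norm_prime_pow, ← norm_mul]
  congr 2
  ring

theorem setIntegral_eq_add_scaled (hm : m (padicBall p 0) = 1) (hs : 0 < s) :
    ∫ z in padicBall p 0 ×ˢ padicBall p 0, ‖z.2 ^ 3 - z.1 ^ 3 * z.2‖ ^ s ∂m.prod m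
      = (1 - (p : ℝ)⁻¹) * (normPowIntegral m s - (p : ℝ)⁻¹)
        + (p : ℝ)⁻¹ * (p : ℝ)⁻¹ ^ s * normPowIntegral m s * (1 - (p : ℝ)⁻¹)
        + ((p : ℝ)⁻¹ * (1 - (p : ℝ)⁻¹) ^ 2 * (1 + (p : ℝ)⁻¹ * ((p : ℝ)⁻¹ ^ s) ^ 3)
          + (p : ℝ)⁻¹ ^ 3 * (1 - (p : ℝ)⁻¹) * ((p : ℝ)⁻¹ ^ s) ^ 5 * normPowIntegral m s)
        + (p : ℝ)⁻¹ ^ 2 * (1 - (p : ℝ)⁻¹) *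
          (1 + (p : ℝ)⁻¹ * ((p : ℝ)⁻¹ ^ s) ^ 3 + (p : ℝ)⁻¹ ^ 2 * ((p : ℝ)⁻¹ ^ s) ^ 6)
        + (p : ℝ)⁻¹ ^ 5 * ((p : ℝ)⁻¹ ^ s) ^ 9 *
          ∫ z in padicBall p 0 ×ˢ padicBall p 0, ‖z.2 ^ 3 - z.1 ^ 3 * z.2‖ ^ s ∂m.prod m := by
  have hF := continuous_norm_cube_sub_cube_mul_rpow (p := p) hs
  have hU : padicBall p 1 \ padicBall p 2 ⊆ padicBall p 0 :=
    Set.sdiff_subset.trans (padicBall_succ_subset 0)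
  have hB : padicBall p 2 ⊆ padicBall p 0 :=
    (padicBall_succ_subset 1).trans (padicBall_succ_subset 0)
  have hUm : MeasurableSet (padicBall p 1 \ padicBall p 2) :=
    (measurableSet_padicBall 1).diff (measurableSet_padicBall 2)
  have hlt (k j : ℕ) (hkj : 2 * j < 3 * k) (x : ℚ_[p]) (hx : ‖x‖ ≤ (p : ℝ)⁻¹ ^ k) :
      ‖x‖ ^ 3 < ((p : ℝ)⁻¹ ^ j) ^ 2 := by
    refine (pow_le_pow_left₀ (norm_nonneg _) hx 3).trans_lt ?_
    rw [← pow_mul, ← pow_mul]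
    exact pow_lt_pow_right_of_lt_one₀ inv_prime_pos inv_prime_lt_one (by omega)
  have hlt1 (j : ℕ) (hj : 2 * j < 3) : ∀ x ∈ padicBall p 1 \ padicBall p 2, _ :=
    fun x hx ↦ hlt 1 j (by omega) x (mem_padicBall.1 hx.1)
  have hlt2 (j : ℕ) (hj : 2 * j < 6) : ∀ x ∈ padicBall p 2, _ :=
    fun x hx ↦ hlt 2 j (by omega) x (mem_padicBall.1 hx)
  have e0 := setIntegral_padicBall_prod_eq_add m hF 0 0
  have e1 := setIntegral_padicBall_prod_eq_add m hF 1 0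
  have e2 := setIntegral_prod_padicBall_eq_add m hF hUm hU 0
  have e3 := setIntegral_prod_padicBall_eq_add m hF hUm hU 1
  have e4 := setIntegral_prod_padicBall_eq_add m hF (measurableSet_padicBall 2) hB 0
  have e5 := setIntegral_prod_padicBall_eq_add m hF (measurableSet_padicBall 2) hB 1
  have e6 := setIntegral_prod_padicBall_eq_add m hF (measurableSet_padicBall 2) hB 2
  rw [setIntegral_prod_sphere m hm hUm (hlt1 _ (by norm_num))] at e2 e3
  rw [setIntegral_prod_sphere m hm (measurableSet_padicBall 2) (hlt2 _ (by norm_num))] at e4 e5 e6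
  rw [measureReal_padicBall_diff m hm 1] at e2 e3
  rw [measureReal_padicBall m hm] at e4 e5 e6
  norm_num only [zero_add, Nat.reduceAdd] at e0 e1 e2 e3 e4 e5 e6
  rw [setIntegral_sphere_prod_padicBall_two m hm] at e3
  rw [setIntegral_padicBall_two_prod_three m hm hs] at e6
  rw [setIntegral_units_prod m hm hs] at e0
  linear_combination e0 + e1 + e2 + e3 + e4 + e5 + e6

end PadicBall

theorem exists_isAddHaarMeasure_prod_self_eq {p : ℕ} [Fact p.Prime]
    [MeasurableSpace ℚ_[p]] [BorelSpace ℚ_[p]]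
    (μ : Measure (ℚ_[p] × ℚ_[p])) [μ.IsAddHaarMeasure]
    (hμ : μ (padicBall p 0 ×ˢ padicBall p 0) = 1) :
    ∃ m : Measure ℚ_[p], m.IsAddHaarMeasure ∧ m (padicBall p 0) = 1 ∧ μ = m.prod m := by
  let K : TopologicalSpace.PositiveCompacts ℚ_[p] :=
    ⟨⟨padicBall p 0, isCompact_padicBall 0⟩,
      ⟨0, mem_interior_iff_mem_nhds.2 (Metric.closedBall_mem_nhds 0 (by simp))⟩⟩
  have hK : Measure.addHaarMeasure K (padicBall p 0) = 1 := Measure.addHaarMeasure_self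
  refine ⟨Measure.addHaarMeasure K, inferInstance, hK, ?_⟩
  have h := Measure.isAddLeftInvariant_eq_smul μ
    ((Measure.addHaarMeasure K).prod (Measure.addHaarMeasure K))
  have hc := hμ
  rw [h, Measure.smul_apply, Measure.prod_prod, hK, mul_one, ENNReal.smul_def, smul_eq_mul,
    mul_one, ENNReal.coe_eq_one] at hc
  rw [h, hc, one_smul]

/-- The Igusa local zeta function of the `E₇`-singularity `f(x,y) = y³ − x³y`. -/
theorem stmt_15 (p : ℕ) [Fact p.Prime] (hp : 3 < p)
    [MeasurableSpace ℚ_[p]] [BorelSpace ℚ_[p]]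
    (μ : Measure (ℚ_[p] × ℚ_[p])) [μ.IsAddHaarMeasure]
    (hμ : μ ({x : ℚ_[p] | ‖x‖ ≤ 1} ×ˢ {y : ℚ_[p] | ‖y‖ ≤ 1}) = 1)
    (s : ℝ) (hs : 0 < s) :
    (∫ z in ({x : ℚ_[p] | ‖x‖ ≤ 1} ×ˢ {y : ℚ_[p] | ‖y‖ ≤ 1}),
        ‖z.2 ^ 3 - z.1 ^ 3 * z.2‖ ^ s ∂μ)
      = (p : ℝ) ^ (3 * s) * ((p : ℝ) - 1) *
          ((p : ℝ) ^ (7 * s + 5) - (p : ℝ) ^ (7 * s + 4) + (p : ℝ) ^ (6 * s + 4)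
            - (p : ℝ) ^ (6 * s + 3) + (p : ℝ) ^ (4 * s + 3) - (p : ℝ) ^ (3 * s + 2)
            + (p : ℝ) ^ (2 * s + 2) - (p : ℝ) ^ (2 * s + 1) + (p : ℝ) ^ (s + 1) - 1) /
          (((p : ℝ) ^ (9 * s + 5) - 1) * ((p : ℝ) ^ (s + 1) - 1)) := by
  have hball : {x : ℚ_[p] | ‖x‖ ≤ 1} = padicBall p 0 := by
    ext x
    rw [mem_padicBall, pow_zero, Set.mem_ofPred_eq]
  rw [hball] at hμ ⊢
  obtain ⟨m, hm_haar, hm, rfl⟩ := exists_isAddHaarMeasure_prod_self_eq μ hμ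
  have hZ := setIntegral_eq_add_scaled m hm hs
  have hJ := normPowIntegral_eq m hm hs
  generalize (∫ z in padicBall p 0 ×ˢ padicBall p 0,
    ‖z.2 ^ 3 - z.1 ^ 3 * z.2‖ ^ s ∂m.prod m) = Z at hZ ⊢
  generalize normPowIntegral m s = J at hZ hJ
  have hp1 : 1 < (p : ℝ) := by exact_mod_cast (by omega : 1 < p)
  have hp0 : 0 < (p : ℝ) := one_pos.trans hp1
  have hT1 : 1 < (p : ℝ) ^ s := Real.one_lt_rpow hp1 hs
  have hmul (a b : ℕ) : (p : ℝ) ^ ((a : ℝ) * s + b) = ((p : ℝ) ^ s) ^ a * (p : ℝ) ^ b := by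
    rw [Real.rpow_add hp0, mul_comm (a : ℝ) s, Real.rpow_mul hp0.le, Real.rpow_natCast,
      Real.rpow_natCast]
  have e3 : (p : ℝ) ^ (3 * s) = ((p : ℝ) ^ s) ^ 3 := by simpa using hmul 3 0
  have e75 := hmul 7 5
  have e74 := hmul 7 4
  have e64 := hmul 6 4
  have e63 := hmul 6 3
  have e43 := hmul 4 3
  have e32 := hmul 3 2
  have e22 := hmul 2 2
  have e21 := hmul 2 1
  have e11 := hmul 1 1
  have e95 := hmul 9 5
  norm_num only [Nat.cast_ofNat, Nat.cast_one, one_mul, pow_one]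
    at e75 e74 e64 e63 e43 e32 e22 e21 e11 e95
  rw [Real.inv_rpow hp0.le] at hZ hJ
  rw [e3, e75, e74, e64, e63, e43, e32, e22, e21, e11, e95]
  generalize (p : ℝ) ^ s = T at *
  generalize (p : ℝ) = P at *
  have hTP : 0 < T * P - 1 := by nlinarith
  have hTP9 : 0 < T ^ 9 * P ^ 5 - 1 :=
    sub_pos.2 (one_lt_mul_of_lt_of_le (one_lt_pow₀ hT1 (by norm_num)) (one_le_pow₀ hp1.le))
  have hT0 : 0 < T := one_pos.trans hT1
  have hJ' : J * (T * P - 1) = T * (P - 1) := by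
    field_simp at hJ
    linear_combination hJ
  rw [eq_div_iff (mul_pos hTP9 hTP).ne']
  field_simp at hZ
  linear_combination (T * P - 1) * hZ +
    (P - 1) * (T ^ 9 * P ^ 4 + T ^ 8 * P ^ 3 + T ^ 4 * P) * hJ'
end

section
/- Let p be a prime with p > 3 and let s > 0 be real. Let μ be the Haar measure on ℚ_p² normalized so that μ(ℤ_p²) = 1. Then ∫_{ℤ_p²} |y³ − x⁵|_p^s dμ(x,y) = (p−1) p^{3s} ( p^{13s+8} − p^{12s+6} + p^{10s+6} − p^{9s+5} + p^{8s+5} − p^{6s+3} + p^{4s+3} − p^{2s+1} + p^{s+1} − 1 ) / [ (p^{15s+8} − 1)(p^{s+1} − 1) ]. -/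
open MeasureTheory

namespace Padic

open Metric

variable {p : ℕ} [Fact p.Prime]

lemma inv_cast_pos : 0 < (p : ℝ)⁻¹ := by
  have := (Fact.out : p.Prime).pos
  positivity

lemma inv_cast_lt_one : (p : ℝ)⁻¹ < 1 :=
  inv_lt_one_of_one_lt₀ (by exact_mod_cast (Fact.out : p.Prime).one_lt)

lemma norm_lt_inv_pow_iff (x : ℚ_[p]) (k : ℕ) :
    ‖x‖ < (p : ℝ)⁻¹ ^ k ↔ ‖x‖ ≤ (p : ℝ)⁻¹ ^ (k + 1) := by
  have h := norm_lt_pow_iff_norm_le_pow_sub_one x (-(k : ℤ))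
  rw [show (-(k : ℤ) - 1) = -((k + 1 : ℕ) : ℤ) by push_cast; ring, zpow_neg, zpow_neg,
    zpow_natCast, zpow_natCast, ← inv_pow, ← inv_pow] at h
  exact h

lemma closedBall_inv_pow_eq_union (k : ℕ) :
    closedBall (0 : ℚ_[p]) ((p : ℝ)⁻¹ ^ k) =
      sphere 0 ((p : ℝ)⁻¹ ^ k) ∪ closedBall 0 ((p : ℝ)⁻¹ ^ (k + 1)) := by
  ext x
  simp only [Set.mem_union, mem_closedBall_zero_iff, mem_sphere_zero_iff_norm,
    ← norm_lt_inv_pow_iff]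
  rw [le_iff_lt_or_eq, or_comm]

lemma disjoint_sphere_closedBall_inv_pow (k : ℕ) :
    Disjoint (sphere (0 : ℚ_[p]) ((p : ℝ)⁻¹ ^ k)) (closedBall 0 ((p : ℝ)⁻¹ ^ (k + 1))) := by
  rw [Set.disjoint_left]
  intro x hx hx'
  rw [mem_closedBall_zero_iff, ← norm_lt_inv_pow_iff] at hx'
  exact hx'.ne (mem_sphere_zero_iff_norm.1 hx)

lemma closedBall_one_eq_iUnion :
    closedBall (0 : ℚ_[p]) 1 = ⋃ i : Fin p, closedBall ((i : ℕ) : ℚ_[p]) (p : ℝ)⁻¹ := by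
  ext x
  simp only [Set.mem_iUnion, mem_closedBall, dist_eq_norm, sub_zero]
  constructor
  · intro hx
    obtain ⟨n, hn, h⟩ := PadicInt.exists_mem_range (⟨x, hx⟩ : ℤ_[p])
    refine ⟨⟨n, hn⟩, ?_⟩
    rw [PadicInt.maximalIdeal_eq_span_p, ← pow_one (p : ℤ_[p]),
      ← PadicInt.norm_le_pow_iff_mem_span_pow] at h
    rw [Nat.cast_one, zpow_neg_one, PadicInt.norm_def] at h
    exact h
  · rintro ⟨i, hi⟩
    rw [← sub_add_cancel x ((i : ℕ) : ℚ_[p])]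
    refine (nonarchimedean _ _).trans (max_le (hi.trans inv_cast_lt_one.le) ?_)
    exact_mod_cast Padic.norm_int_le_one (p := p) ((i : ℕ) : ℤ)

lemma pairwise_disjoint_closedBall_natCast :
    Pairwise (Function.onFun Disjoint
      fun i : Fin p ↦ closedBall ((i : ℕ) : ℚ_[p]) (p : ℝ)⁻¹) := by
  intro i j hij
  rw [Function.onFun, Set.disjoint_left]
  intro x hi hj
  rw [mem_closedBall, dist_eq_norm] at hi hj
  have h : ‖(((i : ℕ) - (j : ℕ) : ℤ) : ℚ_[p])‖ < 1 := by
    have := nonarchimedean (x - ((j : ℕ) : ℚ_[p])) (-(x - ((i : ℕ) : ℚ_[p])))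
    rw [norm_neg] at this
    push_cast
    rw [show ((i : ℕ) : ℚ_[p]) - (j : ℕ) = x - (j : ℕ) + -(x - (i : ℕ)) by ring]
    exact this.trans_lt ((max_le hj hi).trans_lt inv_cast_lt_one)
  rw [norm_intCast_lt_one_iff] at h
  obtain ⟨c, hc⟩ := h
  have hi := i.2
  have hj := j.2
  apply hij
  ext
  have hc0 : c = 0 := by
    by_contra hne
    rcases lt_or_gt_of_ne hne with h | h <;> nlinarith
  subst hc0
  omega

lemma preimage_natCast_pow_mul_closedBall (k : ℕ) :
    ((p : ℚ_[p]) ^ k * ·) ⁻¹' closedBall 0 ((p : ℝ)⁻¹ ^ k) = closedBall 0 1 := by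
  have : 0 < ((p : ℝ) ^ k)⁻¹ := by rw [← inv_pow]; exact pow_pos inv_cast_pos k
  ext x
  simp [this]

lemma rpow_inv_pow_pow (s : ℝ) (b n : ℕ) :
    (((p : ℝ)⁻¹ ^ b) ^ n) ^ s = ((p : ℝ)⁻¹ ^ s) ^ (n * b) := by
  rw [← pow_mul, ← Real.rpow_natCast, ← Real.rpow_mul inv_cast_pos.le, mul_comm _ s,
    Real.rpow_mul inv_cast_pos.le, Real.rpow_natCast, mul_comm b n]

lemma inv_pow_pow_lt_inv_pow_pow {a b k n : ℕ} (h : n * b < k * a) :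
    ((p : ℝ)⁻¹ ^ a) ^ k < ((p : ℝ)⁻¹ ^ b) ^ n := by
  rw [← pow_mul, ← pow_mul]
  exact pow_lt_pow_right_of_lt_one₀ inv_cast_pos inv_cast_lt_one (by linarith)

lemma continuous_norm_cube_sub_pow_five_rpow {s : ℝ} (hs : 0 < s) :
    Continuous fun z : ℚ_[p] × ℚ_[p] ↦ ‖z.2 ^ 3 - z.1 ^ 5‖ ^ s :=
  ((continuous_snd.pow 3).sub (continuous_fst.pow 5)).norm.rpow_const fun _ ↦ Or.inr hs.le

section Measure

variable [MeasurableSpace ℚ_[p]] [BorelSpace ℚ_[p]]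
  (m : Measure ℚ_[p]) [m.IsAddHaarMeasure]

lemma exists_map_mul_left_eq_smul (hm : m (closedBall 0 1) = 1) {c : ℚ_[p]} (hc : c ≠ 0) :
    m.map (c * ·) = m ((c * ·) ⁻¹' closedBall 0 1) • m := by
  have heq : (c * ·) = ⇑(ContinuousLinearEquiv.unitsEquivAut ℚ_[p] (Units.mk0 c hc)) :=
    funext fun x ↦ mul_comm c x
  have hH : (m.map (c * ·)).IsAddHaarMeasure := by
    rw [heq]
    exact ContinuousLinearEquiv.isAddHaarMeasure_map _ m
  let K : TopologicalSpace.PositiveCompacts ℚ_[p] :=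
    ⟨⟨closedBall 0 1, isCompact_closedBall _ _⟩,
      ⟨0, mem_interior_iff_mem_nhds.2 (closedBall_mem_nhds _ one_pos)⟩⟩
  have h1 := Measure.addHaarMeasure_unique m K
  have h2 := Measure.addHaarMeasure_unique (m.map (c * ·)) K
  have hK : (K : Set ℚ_[p]) = closedBall 0 1 := rfl
  rw [hK, hm, one_smul] at h1
  rw [hK, ← h1, Measure.map_apply (measurable_const_mul c) measurableSet_closedBall] at h2
  exact h2

lemma map_mul_left_of_norm_eq_one (hm : m (closedBall 0 1) = 1) {u : ℚ_[p]} (hu : ‖u‖ = 1) :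
    m.map (u * ·) = m := by
  have hu0 : u ≠ 0 := by rintro rfl; simp at hu
  rw [exists_map_mul_left_eq_smul m hm hu0]
  have hpre : (u * ·) ⁻¹' closedBall 0 1 = closedBall 0 1 := by
    ext x
    simp [hu]
  rw [hpre, hm, one_smul]

lemma measure_closedBall_inv (hm : m (closedBall 0 1) = 1) :
    (p : ENNReal) * m (closedBall 0 (p : ℝ)⁻¹) = 1 := by
  rw [← hm, closedBall_one_eq_iUnion, measure_iUnion pairwise_disjoint_closedBall_natCast
    fun _ ↦ measurableSet_closedBall]
  have (i : Fin p) : m (closedBall ((i : ℕ) : ℚ_[p]) (p : ℝ)⁻¹) =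
      m (closedBall 0 (p : ℝ)⁻¹) := by
    rw [← measure_preimage_add m ((i : ℕ) : ℚ_[p])]
    congr 1
    ext x
    simp
  simp [this]

lemma map_natCast_mul_left (hm : m (closedBall 0 1) = 1) :
    m.map ((p : ℚ_[p]) * ·) = (p : ENNReal) • m := by
  have hp0 : (p : ℚ_[p]) ≠ 0 := Nat.cast_ne_zero.2 (Fact.out : p.Prime).ne_zero
  have h := exists_map_mul_left_eq_smul m hm hp0
  have h' := DFunLike.congr_fun h (closedBall 0 (p : ℝ)⁻¹)
  rw [Measure.map_apply (measurable_const_mul _) measurableSet_closedBall] at h'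
  have hpre : ((p : ℚ_[p]) * ·) ⁻¹' closedBall 0 (p : ℝ)⁻¹ = closedBall 0 1 := by
    simpa using preimage_natCast_pow_mul_closedBall (p := p) 1
  rw [hpre, hm, Measure.smul_apply, smul_eq_mul] at h'
  rw [h, ENNReal.eq_inv_of_mul_eq_one_left h'.symm,
    ENNReal.eq_inv_of_mul_eq_one_left (measure_closedBall_inv m hm)]

lemma map_natCast_pow_mul_left (hm : m (closedBall 0 1) = 1) (k : ℕ) :
    m.map ((p : ℚ_[p]) ^ k * ·) = (p : ENNReal) ^ k • m := by
  induction k with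
  | zero => simp
  | succ k ih =>
    have : (((p : ℚ_[p]) ^ (k + 1)) * ·) = ((p : ℚ_[p]) * ·) ∘ ((p : ℚ_[p]) ^ k * ·) := by
      ext x
      simp [pow_succ']
      ring
    rw [this, ← Measure.map_map (measurable_const_mul _) (measurable_const_mul _), ih,
      Measure.map_smul, map_natCast_mul_left m hm, smul_smul, pow_succ]

lemma measureReal_closedBall_inv_pow (hm : m (closedBall 0 1) = 1) (k : ℕ) :
    m.real (closedBall 0 ((p : ℝ)⁻¹ ^ k)) = (p : ℝ)⁻¹ ^ k := by
  have h := DFunLike.congr_fun (map_natCast_pow_mul_left m hm k)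
    (closedBall 0 ((p : ℝ)⁻¹ ^ k))
  rw [Measure.map_apply (measurable_const_mul _) measurableSet_closedBall,
    preimage_natCast_pow_mul_closedBall, hm, Measure.smul_apply, smul_eq_mul, mul_comm] at h
  rw [measureReal_def, ENNReal.eq_inv_of_mul_eq_one_left h.symm]
  simp

lemma measureReal_sphere_inv_pow (hm : m (closedBall 0 1) = 1) (k : ℕ) :
    m.real (sphere 0 ((p : ℝ)⁻¹ ^ k)) = (p : ℝ)⁻¹ ^ k * (1 - (p : ℝ)⁻¹) := by
  have h := measureReal_union (μ := m) (disjoint_sphere_closedBall_inv_pow (p := p) k)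
    measurableSet_closedBall (isCompact_sphere _ _).measure_lt_top.ne
    (isCompact_closedBall _ _).measure_lt_top.ne
  rw [← closedBall_inv_pow_eq_union, measureReal_closedBall_inv_pow m hm,
    measureReal_closedBall_inv_pow m hm] at h
  rw [pow_succ] at h
  linarith

lemma setIntegral_sphere_mul_left (hm : m (closedBall 0 1) = 1) {u : ℚ_[p]} (hu : ‖u‖ = 1)
    (f : ℚ_[p] → ℝ) :
    ∫ y in sphere 0 1, f (u * y) ∂m = ∫ y in sphere 0 1, f y ∂m := by
  have hu0 : u ≠ 0 := by rintro rfl; simp at hu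
  have h := MeasurePreserving.setIntegral_preimage_emb (f := (u * ·))
    ⟨measurable_const_mul u, map_mul_left_of_norm_eq_one m hm hu⟩
    (Homeomorph.mulLeft₀ u hu0).measurableEmbedding f (sphere 0 1)
  convert h using 3
  ext x
  simp [hu]

lemma setIntegral_closedBall_inv_pow_eq_add {f : ℚ_[p] → ℝ} (hf : Continuous f) (k : ℕ) :
    ∫ x in closedBall 0 ((p : ℝ)⁻¹ ^ k), f x ∂m = ∫ x in sphere 0 ((p : ℝ)⁻¹ ^ k), f x ∂m +
      ∫ x in closedBall 0 ((p : ℝ)⁻¹ ^ (k + 1)), f x ∂m := by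
  rw [closedBall_inv_pow_eq_union, setIntegral_union (disjoint_sphere_closedBall_inv_pow k)
    measurableSet_closedBall
    (hf.continuousOn.integrableOn_compact (isCompact_sphere _ _))
    (hf.continuousOn.integrableOn_compact (isCompact_closedBall _ _))]

lemma setIntegral_closedBall_norm_rpow (hm : m (closedBall 0 1) = 1) {s : ℝ} (hs : 0 < s) :
    (∫ x in closedBall 0 1, ‖x‖ ^ s ∂m) * (1 - (p : ℝ)⁻¹ ^ s * (p : ℝ)⁻¹) = 1 - (p : ℝ)⁻¹ := by
  have hcont : Continuous fun x : ℚ_[p] ↦ ‖x‖ ^ s :=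
    continuous_norm.rpow_const fun _ ↦ Or.inr hs.le
  have hpeel := setIntegral_closedBall_inv_pow_eq_add m hcont 0
  have hsph : ∫ x in sphere 0 1, ‖x‖ ^ s ∂m = 1 - (p : ℝ)⁻¹ := by
    have h := measureReal_sphere_inv_pow m hm 0
    rw [pow_zero, one_mul] at h
    rw [setIntegral_congr_fun (g := fun _ ↦ (1 : ℝ)) isClosed_sphere.measurableSet
      fun x hx ↦ by simp [mem_sphere_zero_iff_norm.1 hx], setIntegral_const, h, smul_eq_mul,
      mul_one]
  have hscale : ∫ x in closedBall 0 (p : ℝ)⁻¹, ‖x‖ ^ s ∂m =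
      (p : ℝ)⁻¹ * (p : ℝ)⁻¹ ^ s * ∫ x in closedBall 0 1, ‖x‖ ^ s ∂m := by
    have hp0 : (p : ℚ_[p]) ≠ 0 := Nat.cast_ne_zero.2 (Fact.out : p.Prime).ne_zero
    have h := (Homeomorph.mulLeft₀ (p : ℚ_[p]) hp0).measurableEmbedding.setIntegral_map
      (μ := m) (fun x ↦ ‖x‖ ^ s) (closedBall 0 (p : ℝ)⁻¹)
    have hpre := preimage_natCast_pow_mul_closedBall (p := p) 1
    rw [pow_one, pow_one] at hpre
    rw [Homeomorph.coe_mulLeft₀, map_natCast_mul_left m hm, hpre, Measure.restrict_smul,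
      integral_smul_measure] at h
    simp only [norm_mul, Padic.norm_p, Real.mul_rpow inv_cast_pos.le (norm_nonneg _),
      integral_const_mul, ENNReal.toReal_natCast, smul_eq_mul] at h
    rw [mul_assoc, ← h, inv_mul_cancel_left₀]
    exact_mod_cast (Fact.out : p.Prime).ne_zero
  rw [pow_zero, zero_add, pow_one, hsph, hscale] at hpeel
  linear_combination hpeel

lemma setIntegral_sphere_norm_sub_one_rpow (hm : m (closedBall 0 1) = 1) {s : ℝ} (hs : 0 < s) :
    ∫ x in sphere 0 1, ‖x - 1‖ ^ s ∂m = (∫ x in closedBall 0 1, ‖x‖ ^ s ∂m) - (p : ℝ)⁻¹ := by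
  have hcont : Continuous fun x : ℚ_[p] ↦ ‖x - 1‖ ^ s :=
    (continuous_id.sub continuous_const).norm.rpow_const fun _ ↦ Or.inr hs.le
  have hpeel := setIntegral_closedBall_inv_pow_eq_add m hcont 0
  have hball : ∫ x in closedBall 0 (p : ℝ)⁻¹, ‖x - 1‖ ^ s ∂m = (p : ℝ)⁻¹ := by
    have h := measureReal_closedBall_inv_pow m hm 1
    rw [pow_one] at h
    rw [setIntegral_congr_fun (g := fun _ ↦ (1 : ℝ)) measurableSet_closedBall, setIntegral_const,
      h, smul_eq_mul, mul_one]
    intro x hx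
    have hx1 : ‖x‖ < 1 := (mem_closedBall_zero_iff.1 hx).trans_lt inv_cast_lt_one
    have : ‖x - 1‖ = 1 := by
      rw [sub_eq_add_neg, add_eq_max_of_ne (by simpa using hx1.ne)]
      simpa using hx1.le
    simp [this]
  have htrans : ∫ x in closedBall 0 1, ‖x - 1‖ ^ s ∂m = ∫ x in closedBall 0 1, ‖x‖ ^ s ∂m := by
    have h := (measurePreserving_sub_right m (1 : ℚ_[p])).setIntegral_preimage_emb
      (measurableEmbedding_subRight 1) (fun x ↦ ‖x‖ ^ s) (closedBall 0 1)
    convert h using 3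
    ext x
    have h1 : (1 : ℚ_[p]) ∈ closedBall (0 : ℚ_[p]) 1 := by simp
    rw [Set.mem_preimage, mem_closedBall_zero_iff (a := x - 1), ← dist_eq_norm, ← mem_closedBall,
      IsUltrametricDist.closedBall_eq_of_mem h1]
  rw [pow_zero, zero_add, pow_one, hball, htrans] at hpeel
  linear_combination -hpeel

section Cusp

variable {s : ℝ}

lemma setIntegral_prod_closedBall_inv_pow_eq_add {f : ℚ_[p] × ℚ_[p] → ℝ} (hf : Continuous f)
    (k : ℕ) {T : Set ℚ_[p]} (hT : IsCompact T) :
    ∫ z in closedBall 0 ((p : ℝ)⁻¹ ^ k) ×ˢ T, f z ∂m.prod m =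
      ∫ z in sphere 0 ((p : ℝ)⁻¹ ^ k) ×ˢ T, f z ∂m.prod m +
        ∫ z in closedBall 0 ((p : ℝ)⁻¹ ^ (k + 1)) ×ˢ T, f z ∂m.prod m := by
  rw [closedBall_inv_pow_eq_union, Set.union_prod, setIntegral_union
    (Set.disjoint_prod.2 (Or.inl (disjoint_sphere_closedBall_inv_pow k)))
    (measurableSet_closedBall.prod hT.measurableSet)
    (hf.continuousOn.integrableOn_compact ((isCompact_sphere _ _).prod hT))
    (hf.continuousOn.integrableOn_compact ((isCompact_closedBall _ _).prod hT))]

lemma setIntegral_closedBall_inv_pow_prod_eq_add {f : ℚ_[p] × ℚ_[p] → ℝ} (hf : Continuous f)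
    (k : ℕ) {S : Set ℚ_[p]} (hS : IsCompact S) :
    ∫ z in S ×ˢ closedBall 0 ((p : ℝ)⁻¹ ^ k), f z ∂m.prod m =
      ∫ z in S ×ˢ sphere 0 ((p : ℝ)⁻¹ ^ k), f z ∂m.prod m +
        ∫ z in S ×ˢ closedBall 0 ((p : ℝ)⁻¹ ^ (k + 1)), f z ∂m.prod m := by
  rw [closedBall_inv_pow_eq_union, Set.prod_union, setIntegral_union
    (Set.disjoint_prod.2 (Or.inr (disjoint_sphere_closedBall_inv_pow k)))
    (hS.measurableSet.prod measurableSet_closedBall)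
    (hf.continuousOn.integrableOn_compact (hS.prod (isCompact_sphere _ _)))
    (hf.continuousOn.integrableOn_compact (hS.prod (isCompact_closedBall _ _)))]

lemma setIntegral_prod_sphere_norm_cube_sub_pow_five {a b : ℕ} (h : 3 * b < 5 * a)
    {S : Set ℚ_[p]} (hS : MeasurableSet S) (hSa : S ⊆ closedBall 0 ((p : ℝ)⁻¹ ^ a)) :
    ∫ z in S ×ˢ sphere 0 ((p : ℝ)⁻¹ ^ b), ‖z.2 ^ 3 - z.1 ^ 5‖ ^ s ∂m.prod m =
      m.real S * m.real (sphere 0 ((p : ℝ)⁻¹ ^ b)) * ((p : ℝ)⁻¹ ^ s) ^ (3 * b) := by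
  rw [setIntegral_congr_fun (g := fun _ ↦ ((p : ℝ)⁻¹ ^ s) ^ (3 * b))
    (hS.prod isClosed_sphere.measurableSet), setIntegral_const, measureReal_prod_prod, smul_eq_mul]
  rintro ⟨x, y⟩ ⟨hx, hy⟩
  have hx' := mem_closedBall_zero_iff.1 (hSa hx)
  have hy' := mem_sphere_zero_iff_norm.1 hy
  have hlt : ‖x ^ 5‖ < ‖y ^ 3‖ := by
    rw [norm_pow, norm_pow, hy']
    exact (pow_le_pow_left₀ (norm_nonneg _) hx' 5).trans_lt (inv_pow_pow_lt_inv_pow_pow h)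
  have : ‖y ^ 3 - x ^ 5‖ = ((p : ℝ)⁻¹ ^ b) ^ 3 := by
    rw [sub_eq_add_neg, add_eq_max_of_ne (by simpa only [norm_neg] using hlt.ne'), norm_neg,
      max_eq_left hlt.le, norm_pow, hy']
  simp only [this, rpow_inv_pow_pow]

lemma setIntegral_sphere_prod_norm_cube_sub_pow_five {a b : ℕ} (h : 5 * a < 3 * b) :
    ∫ z in sphere 0 ((p : ℝ)⁻¹ ^ a) ×ˢ closedBall 0 ((p : ℝ)⁻¹ ^ b),
        ‖z.2 ^ 3 - z.1 ^ 5‖ ^ s ∂m.prod m =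
      m.real (sphere 0 ((p : ℝ)⁻¹ ^ a)) * m.real (closedBall 0 ((p : ℝ)⁻¹ ^ b)) *
        ((p : ℝ)⁻¹ ^ s) ^ (5 * a) := by
  rw [setIntegral_congr_fun (g := fun _ ↦ ((p : ℝ)⁻¹ ^ s) ^ (5 * a))
    (isClosed_sphere.measurableSet.prod measurableSet_closedBall), setIntegral_const,
    measureReal_prod_prod, smul_eq_mul]
  rintro ⟨x, y⟩ ⟨hx, hy⟩
  have hx' := mem_sphere_zero_iff_norm.1 hx
  have hy' := mem_closedBall_zero_iff.1 hy
  have hlt : ‖y ^ 3‖ < ‖x ^ 5‖ := by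
    rw [norm_pow, norm_pow, hx']
    exact (pow_le_pow_left₀ (norm_nonneg _) hy' 3).trans_lt (inv_pow_pow_lt_inv_pow_pow h)
  have : ‖y ^ 3 - x ^ 5‖ = ((p : ℝ)⁻¹ ^ a) ^ 5 := by
    rw [sub_eq_add_neg, add_eq_max_of_ne (by simpa only [norm_neg] using hlt.ne), norm_neg,
      max_eq_right hlt.le, norm_pow, hx']
  simp only [this, rpow_inv_pow_pow]

lemma setIntegral_sphere_swap {f : ℚ_[p] → ℚ_[p] → ℝ} (hf : Continuous (Function.uncurry f)) :
    ∫ x in sphere 0 1, ∫ y in sphere 0 1, f x y ∂m ∂m =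
      ∫ y in sphere 0 1, ∫ x in sphere 0 1, f x y ∂m ∂m := by
  apply integral_integral_swap
  rw [Measure.prod_restrict]
  exact hf.continuousOn.integrableOn_compact ((isCompact_sphere _ _).prod (isCompact_sphere _ _))

lemma setIntegral_sphere_eq_of_mul_left (hm : m (closedBall 0 1) = 1) {u : ℚ_[p]}
    (hu : ‖u‖ = 1) {f g : ℚ_[p] → ℝ} (h : ∀ y, f (u * y) = g y) :
    ∫ y in sphere 0 1, f y ∂m = ∫ y in sphere 0 1, g y ∂m := by
  rw [← setIntegral_sphere_mul_left m hm hu f]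
  simp only [h]

/-- On pairs of units the cusp is straightened by the unimodular monomial substitution obtained
from the Euclidean algorithm for the exponents `3` and `5`. -/
lemma setIntegral_sphere_prod_sphere_norm_cube_sub_pow_five (hm : m (closedBall 0 1) = 1)
    (hs : 0 < s) :
    ∫ z in sphere 0 1 ×ˢ sphere 0 1, ‖z.2 ^ 3 - z.1 ^ 5‖ ^ s ∂m.prod m =
      (1 - (p : ℝ)⁻¹) * ∫ x in sphere 0 1, ‖x - 1‖ ^ s ∂m := by
  have hmeas : MeasurableSet (sphere (0 : ℚ_[p]) 1) := isClosed_sphere.measurableSet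
  have hm1 : m.real (sphere 0 1) = 1 - (p : ℝ)⁻¹ := by
    simpa using measureReal_sphere_inv_pow m hm 0
  have hint : IntegrableOn (fun z : ℚ_[p] × ℚ_[p] ↦ ‖z.2 ^ 3 - z.1 ^ 5‖ ^ s)
      (sphere 0 1 ×ˢ sphere 0 1) (m.prod m) :=
    (continuous_norm_cube_sub_pow_five_rpow hs).continuousOn.integrableOn_compact
      ((isCompact_sphere _ _).prod (isCompact_sphere _ _))
  have e1 : ∫ x in sphere 0 1, ∫ y in sphere 0 1, ‖y ^ 3 - x ^ 5‖ ^ s ∂m ∂m =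
      ∫ x in sphere 0 1, ∫ y in sphere 0 1, ‖y ^ 3 - x ^ 2‖ ^ s ∂m ∂m := by
    refine setIntegral_congr_fun hmeas fun x hx ↦ ?_
    have hx' := mem_sphere_zero_iff_norm.1 hx
    refine setIntegral_sphere_eq_of_mul_left m hm hx' fun y ↦ ?_
    rw [show (x * y) ^ 3 - x ^ 5 = x ^ 3 * (y ^ 3 - x ^ 2) by ring, norm_mul, norm_pow, hx',
      one_pow, one_mul]
  have e2 : ∫ x in sphere 0 1, ∫ y in sphere 0 1, ‖y ^ 3 - x ^ 2‖ ^ s ∂m ∂m =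
      ∫ y in sphere 0 1, ∫ x in sphere 0 1, ‖y ^ 3 - x ^ 2‖ ^ s ∂m ∂m :=
    setIntegral_sphere_swap m (f := fun x y ↦ ‖y ^ 3 - x ^ 2‖ ^ s)
      (((continuous_snd.pow 3).sub (continuous_fst.pow 2)).norm.rpow_const fun _ ↦ Or.inr hs.le)
  have e3 : ∫ y in sphere 0 1, ∫ x in sphere 0 1, ‖y ^ 3 - x ^ 2‖ ^ s ∂m ∂m =
      ∫ y in sphere 0 1, ∫ x in sphere 0 1, ‖y - x ^ 2‖ ^ s ∂m ∂m := by
    refine setIntegral_congr_fun hmeas fun y hy ↦ ?_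
    have hy' := mem_sphere_zero_iff_norm.1 hy
    refine setIntegral_sphere_eq_of_mul_left m hm hy' fun x ↦ ?_
    rw [show y ^ 3 - (y * x) ^ 2 = y ^ 2 * (y - x ^ 2) by ring, norm_mul, norm_pow, hy',
      one_pow, one_mul]
  have e4 : ∫ y in sphere 0 1, ∫ x in sphere 0 1, ‖y - x ^ 2‖ ^ s ∂m ∂m =
      ∫ x in sphere 0 1, ∫ y in sphere 0 1, ‖y - x ^ 2‖ ^ s ∂m ∂m :=
    setIntegral_sphere_swap m (f := fun y x ↦ ‖y - x ^ 2‖ ^ s)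
      ((continuous_fst.sub (continuous_snd.pow 2)).norm.rpow_const fun _ ↦ Or.inr hs.le)
  have e5 : ∫ x in sphere 0 1, ∫ y in sphere 0 1, ‖y - x ^ 2‖ ^ s ∂m ∂m =
      ∫ x in sphere (0 : ℚ_[p]) 1, ∫ y in sphere 0 1, ‖y - 1‖ ^ s ∂m ∂m := by
    refine setIntegral_congr_fun hmeas fun x hx ↦ ?_
    have hx' : ‖x ^ 2‖ = 1 := by rw [norm_pow, mem_sphere_zero_iff_norm.1 hx, one_pow]
    refine setIntegral_sphere_eq_of_mul_left m hm hx' fun y ↦ ?_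
    rw [show x ^ 2 * y - x ^ 2 = x ^ 2 * (y - 1) by ring, norm_mul, hx', one_mul]
  rw [setIntegral_prod _ hint, e1, e2, e3, e4, e5, setIntegral_const, hm1, smul_eq_mul]

/-- Invariance of the cusp under the weighted dilation `(x, y) ↦ (p³ x, p⁵ y)`. -/
lemma setIntegral_closedBall_prod_dilation (hm : m (closedBall 0 1) = 1) :
    ∫ z in closedBall 0 ((p : ℝ)⁻¹ ^ 3) ×ˢ closedBall 0 ((p : ℝ)⁻¹ ^ 5),
        ‖z.2 ^ 3 - z.1 ^ 5‖ ^ s ∂m.prod m =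
      (p : ℝ)⁻¹ ^ 8 * ((p : ℝ)⁻¹ ^ s) ^ 15 *
        ∫ z in closedBall 0 1 ×ˢ closedBall 0 1, ‖z.2 ^ 3 - z.1 ^ 5‖ ^ s ∂m.prod m := by
  have hp : p ≠ 0 := (Fact.out : p.Prime).ne_zero
  have hp0 (k : ℕ) : (p : ℚ_[p]) ^ k ≠ 0 := pow_ne_zero _ (Nat.cast_ne_zero.2 hp)
  let e := (Homeomorph.mulLeft₀ _ (hp0 3)).prodCongr (Homeomorph.mulLeft₀ _ (hp0 5))
  have he : ⇑e = Prod.map ((p : ℚ_[p]) ^ 3 * ·) ((p : ℚ_[p]) ^ 5 * ·) := rfl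
  have h := e.measurableEmbedding.setIntegral_map (μ := m.prod m)
    (fun z ↦ ‖z.2 ^ 3 - z.1 ^ 5‖ ^ s)
    (closedBall 0 ((p : ℝ)⁻¹ ^ 3) ×ˢ closedBall 0 ((p : ℝ)⁻¹ ^ 5))
  have hmap : (m.prod m).map e = (p : ENNReal) ^ 8 • m.prod m := by
    rw [he, ← Measure.map_prod_map _ _ (measurable_const_mul _) (measurable_const_mul _),
      map_natCast_pow_mul_left m hm, map_natCast_pow_mul_left m hm]
    rw [Measure.prod_smul_left, Measure.prod_smul_right, smul_smul, ← pow_add]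
  have hpre : e ⁻¹' (closedBall 0 ((p : ℝ)⁻¹ ^ 3) ×ˢ closedBall 0 ((p : ℝ)⁻¹ ^ 5)) =
      closedBall 0 1 ×ˢ closedBall 0 1 := by
    rw [he, Set.preimage_prod_map_prod, preimage_natCast_pow_mul_closedBall,
      preimage_natCast_pow_mul_closedBall]
  have hf (z : ℚ_[p] × ℚ_[p]) : ‖(e z).2 ^ 3 - (e z).1 ^ 5‖ ^ s =
      ((p : ℝ)⁻¹ ^ s) ^ 15 * ‖z.2 ^ 3 - z.1 ^ 5‖ ^ s := by
    rw [he, Prod.map_fst, Prod.map_snd, show ((p : ℚ_[p]) ^ 5 * z.2) ^ 3 -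
      ((p : ℚ_[p]) ^ 3 * z.1) ^ 5 = (p : ℚ_[p]) ^ 15 * (z.2 ^ 3 - z.1 ^ 5) by ring, norm_mul,
      Real.mul_rpow (norm_nonneg _) (norm_nonneg _), norm_pow, norm_p]
    have := rpow_inv_pow_pow (p := p) s 1 15
    rw [pow_one, mul_one] at this
    rw [this]
  rw [hmap, hpre, Measure.restrict_smul, integral_smul_measure] at h
  simp only [hf, integral_const_mul, ENNReal.toReal_pow, ENNReal.toReal_natCast, smul_eq_mul] at h
  rw [mul_assoc, ← h, inv_pow _ 8,
    inv_mul_cancel_left₀ (pow_ne_zero _ (Nat.cast_ne_zero.2 hp))]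

/-- The functional equation for the integral of `‖y³ - x⁵‖ ^ s` under the weighted dilation. -/
lemma setIntegral_norm_cube_sub_pow_five_mul (hm : m (closedBall 0 1) = 1) (hs : 0 < s)
    {r t : ℝ} (hr : r = (p : ℝ)⁻¹) (ht : t = (p : ℝ)⁻¹ ^ s) :
    (∫ z in closedBall 0 1 ×ˢ closedBall 0 1, ‖z.2 ^ 3 - z.1 ^ 5‖ ^ s ∂m.prod m) *
        (1 - r ^ 8 * t ^ 15) =
      (1 - r) * ((∫ x in closedBall 0 1, ‖x‖ ^ s ∂m) - r) + (1 - r) * r +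
        (1 - r) * r * ((1 - r) * (1 + r * t ^ 3) + r ^ 2 * t ^ 5) +
        (1 - r) * r ^ 2 * ((1 - r) * (1 + r * t ^ 3 + r ^ 2 * t ^ 6 + r ^ 3 * t ^ 9) +
          r ^ 4 * t ^ 10) +
        r ^ 3 * (1 - r) * (1 + r * t ^ 3 + r ^ 2 * t ^ 6 + r ^ 3 * t ^ 9 + r ^ 4 * t ^ 12) := by
  have hF := continuous_norm_cube_sub_pow_five_rpow (p := p) hs
  have hB (k : ℕ) : IsCompact (closedBall (0 : ℚ_[p]) ((p : ℝ)⁻¹ ^ k)) := isCompact_closedBall _ _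
  have hS (k : ℕ) : IsCompact (sphere (0 : ℚ_[p]) ((p : ℝ)⁻¹ ^ k)) := isCompact_sphere _ _
  have peelX (a : ℕ) := setIntegral_prod_closedBall_inv_pow_eq_add m hF a (hB 0)
  have peelSphere (a b : ℕ) := setIntegral_closedBall_inv_pow_prod_eq_add m hF b (hS a)
  have peelBall (b : ℕ) := setIntegral_closedBall_inv_pow_prod_eq_add m hF b (hB 3)
  have sphereSphere {a b : ℕ} (h : 3 * b < 5 * a) :=
    setIntegral_prod_sphere_norm_cube_sub_pow_five m (s := s) h (hS a).measurableSet
      sphere_subset_closedBall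
  have ballSphere {b : ℕ} (h : 3 * b < 5 * 3) :=
    setIntegral_prod_sphere_norm_cube_sub_pow_five m (s := s) h (hB 3).measurableSet subset_rfl
  have sphereBall {a b : ℕ} (h : 5 * a < 3 * b) :=
    setIntegral_sphere_prod_norm_cube_sub_pow_five m (s := s) h
  have hdil := setIntegral_closedBall_prod_dilation m (s := s) hm
  have hunit := setIntegral_sphere_prod_sphere_norm_cube_sub_pow_five m hm hs
  rw [setIntegral_sphere_norm_sub_one_rpow m hm hs] at hunit
  have h00 := peelX 0
  rw [peelX 1, peelX 2, peelSphere 0 0, sphereBall (a := 0) (b := 0 + 1) (by norm_num),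
    peelSphere 1 0, peelSphere 1 1, sphereSphere (a := 1) (b := 0) (by norm_num),
    sphereSphere (a := 1) (b := 1) (by norm_num), sphereBall (a := 1) (b := 1 + 1) (by norm_num),
    peelSphere 2 0, peelSphere 2 1, peelSphere 2 2, peelSphere 2 3,
    sphereSphere (a := 2) (b := 0) (by norm_num), sphereSphere (a := 2) (b := 1) (by norm_num),
    sphereSphere (a := 2) (b := 2) (by norm_num), sphereSphere (a := 2) (b := 3) (by norm_num),
    sphereBall (a := 2) (b := 3 + 1) (by norm_num),
    peelBall 0, peelBall 1, peelBall 2, peelBall 3, peelBall 4, ballSphere (b := 0) (by norm_num),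
    ballSphere (b := 1) (by norm_num), ballSphere (b := 2) (by norm_num),
    ballSphere (b := 3) (by norm_num), ballSphere (b := 4) (by norm_num), hdil] at h00
  simp only [measureReal_closedBall_inv_pow m hm, measureReal_sphere_inv_pow m hm] at h00
  simp only [pow_zero] at h00
  rw [hunit, ← ht, ← hr] at h00
  linear_combination h00

end Cusp

end Measure

end Padic

/-- The Igusa local zeta function of the `E₈`-singularity `f(x,y) = y³ − x⁵`. -/
theorem stmt_16 (p : ℕ) [Fact p.Prime] (hp : 3 < p)
    [MeasurableSpace ℚ_[p]] [BorelSpace ℚ_[p]]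
    (μ : Measure (ℚ_[p] × ℚ_[p])) [μ.IsAddHaarMeasure]
    (hμ : μ ({x : ℚ_[p] | ‖x‖ ≤ 1} ×ˢ {y : ℚ_[p] | ‖y‖ ≤ 1}) = 1)
    (s : ℝ) (hs : 0 < s) :
    (∫ z in ({x : ℚ_[p] | ‖x‖ ≤ 1} ×ˢ {y : ℚ_[p] | ‖y‖ ≤ 1}),
        ‖z.2 ^ 3 - z.1 ^ 5‖ ^ s ∂μ)
      = ((p : ℝ) - 1) * (p : ℝ) ^ (3 * s) *
          ((p : ℝ) ^ (13 * s + 8) - (p : ℝ) ^ (12 * s + 6) + (p : ℝ) ^ (10 * s + 6)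
            - (p : ℝ) ^ (9 * s + 5) + (p : ℝ) ^ (8 * s + 5) - (p : ℝ) ^ (6 * s + 3)
            + (p : ℝ) ^ (4 * s + 3) - (p : ℝ) ^ (2 * s + 1) + (p : ℝ) ^ (s + 1) - 1) /
          (((p : ℝ) ^ (15 * s + 8) - 1) * ((p : ℝ) ^ (s + 1) - 1)) := by
  have hball : {x : ℚ_[p] | ‖x‖ ≤ 1} = Metric.closedBall 0 1 := by
    ext x
    simp
  rw [hball] at hμ ⊢
  let K : TopologicalSpace.PositiveCompacts ℚ_[p] :=
    ⟨⟨Metric.closedBall 0 1, isCompact_closedBall _ _⟩,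
      ⟨0, mem_interior_iff_mem_nhds.2 (Metric.closedBall_mem_nhds _ one_pos)⟩⟩
  let m : Measure ℚ_[p] := Measure.addHaarMeasure K
  have hm : m (Metric.closedBall 0 1) = 1 := Measure.addHaarMeasure_self (K₀ := K)
  have hKK : ((K ×ˢ K : TopologicalSpace.PositiveCompacts _) : Set (ℚ_[p] × ℚ_[p])) =
      Metric.closedBall 0 1 ×ˢ Metric.closedBall 0 1 := rfl
  have hμm : μ = m.prod m := by
    rw [Measure.addHaarMeasure_unique μ (K ×ˢ K),
      Measure.addHaarMeasure_unique (m.prod m) (K ×ˢ K), hKK, hμ, Measure.prod_prod, hm, one_mul]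
  rw [hμm]
  have hfun := Padic.setIntegral_norm_cube_sub_pow_five_mul m hm hs rfl rfl
  have hlin := Padic.setIntegral_closedBall_norm_rpow m hm hs
  set Z := ∫ z in Metric.closedBall 0 1 ×ˢ Metric.closedBall 0 1,
    ‖z.2 ^ 3 - z.1 ^ 5‖ ^ s ∂m.prod m
  set J := ∫ x in Metric.closedBall 0 1, ‖x‖ ^ s ∂m
  have hq : (1 : ℝ) < p := by exact_mod_cast (Fact.out : p.Prime).one_lt
  have hq0 : (0 : ℝ) < p := one_pos.trans hq
  have hpow (a b : ℕ) : (p : ℝ) ^ ((a : ℝ) * s + b) = ((p : ℝ) ^ s) ^ a * (p : ℝ) ^ b := by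
    rw [Real.rpow_add hq0, mul_comm (a : ℝ) s, Real.rpow_mul hq0.le, Real.rpow_natCast,
      Real.rpow_natCast]
  have hT : 1 < (p : ℝ) ^ s := Real.one_lt_rpow hq hs
  rw [Real.inv_rpow hq0.le] at hfun hlin
  have e3 := hpow 3 0
  have e13 := hpow 13 8
  have e12 := hpow 12 6
  have e10 := hpow 10 6
  have e9 := hpow 9 5
  have e8 := hpow 8 5
  have e6 := hpow 6 3
  have e4 := hpow 4 3
  have e2 := hpow 2 1
  have e1 := hpow 1 1
  have e15 := hpow 15 8
  norm_num only [Nat.cast_ofNat, Nat.cast_zero, Nat.cast_one, add_zero, one_mul, pow_zero, pow_one,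
    mul_one] at e3 e13 e12 e10 e9 e8 e6 e4 e2 e1 e15
  rw [e3, e13, e12, e10, e9, e8, e6, e4, e2, e1, e15]
  set T := (p : ℝ) ^ s
  generalize (p : ℝ) = q at *
  have hT0 : 0 < T := one_pos.trans hT
  have h1 : T * q - 1 ≠ 0 := by nlinarith
  have h2 : T ^ 15 * q ^ 8 - 1 ≠ 0 :=
    (sub_pos.2 (one_lt_mul_of_lt_of_le (one_lt_pow₀ hT (by norm_num))
      (one_le_pow₀ hq.le))).ne'
  have hJ : J * (T * q - 1) = T * (q - 1) := by
    field_simp at hlin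
    linear_combination hlin
  have hZ : Z * (T ^ 15 * q ^ 8 - 1) =
      T ^ 15 * q ^ 8 * (Z * (1 - q⁻¹ ^ 8 * T⁻¹ ^ 15)) := by
    field_simp
  rw [eq_div_iff (mul_ne_zero h2 h1), ← mul_assoc, hZ, hfun]
  field_simp
  linear_combination q ^ 7 * (q - 1) * T ^ 12 * hJ
end
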